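/- Invariance of the probability simplex under the forward equation: let Q : [0,T] → (m×m real matrices) be measurable with entries uniformly bounded, such that each Q_s is a generator matrix (Q_s(i,j) ≥ 0 for j ≠ i and ∑_j Q_s(i,j) = 0 for every i). If ρ is a probability vector and μ : [0,T] → ℝ^m is the continuous solution of μ_t = ρ + ∫_0^t μ_s Q_s ds, then for every t ∈ [0,T], μ_t is a probability vector: μ_t(j) ≥ 0 for all j and ∑_j μ_t(j) = 1. -/

import Mathlib

open MeasureTheory Set

/-- A probability vector on `Fin m`. -/
def IsProbVec {m : ℕ} (ρ : Fin m → ℝ) : Prop :=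
  (∀ i, 0 ≤ ρ i) ∧ ∑ i, ρ i = 1

/-- Integral form of Grönwall's inequality with zero initial value. -/
theorem eq_zero_of_le_mul_integral {u : ℝ → ℝ} {a b C : ℝ} (hu : ContinuousOn u (Icc a b))
    (hu_nonneg : ∀ t ∈ Icc a b, 0 ≤ u t)
    (hu_le : ∀ t ∈ Icc a b, u t ≤ C * ∫ s in a..t, u s) :
    ∀ t ∈ Icc a b, u t = 0 := by
  intro t ht
  have hab : a ≤ b := ht.1.trans ht.2
  set v : ℝ → ℝ := IccExtend hab ((Icc a b).domRestrict u)
  have hv : Continuous v := hu.domRestrict.Icc_extend'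
  have hvu : ∀ s ∈ Icc a b, v s = u s := fun s hs => IccExtend_of_mem hab _ hs
  have hint : ∀ s ∈ Icc a b, ∫ r in a..s, v r = ∫ r in a..s, u r := by
    intro s hs
    refine intervalIntegral.integral_congr fun r hr => ?_
    rw [uIcc_of_le hs.1] at hr
    exact hvu r ⟨hr.1, hr.2.trans hs.2⟩
  have hderiv : ∀ x, HasDerivAt (fun y => ∫ s in a..y, v s) (v x) x := fun x =>
    intervalIntegral.integral_hasDerivAt_right (hv.intervalIntegrable _ _)
      hv.aestronglyMeasurable.stronglyMeasurableAtFilter hv.continuousAt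
  have hzero : ∀ x ∈ Icc a b, ∫ s in a..x, v s = 0 := by
    refine eq_zero_of_abs_deriv_le_mul_abs_self_of_eq_zero_right (K := C) (f' := v)
      (fun x _ => (hderiv x).continuousAt.continuousWithinAt)
      (fun x _ => (hderiv x).hasDerivWithinAt) intervalIntegral.integral_same fun x hx => ?_
    have hx' : x ∈ Icc a b := Ico_subset_Icc_self hx
    have hnn : 0 ≤ ∫ s in a..x, u s :=
      intervalIntegral.integral_nonneg hx'.1 fun s hs => hu_nonneg s ⟨hs.1, hs.2.trans hx'.2⟩
    rw [hint x hx', hvu x hx', Real.norm_of_nonneg (hu_nonneg x hx'), Real.norm_of_nonneg hnn]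
    exact hu_le x hx'
  have h := hu_le t ht
  rw [← hint t ht, hzero t ht, mul_zero] at h
  exact le_antisymm h (hu_nonneg t ht)

/-- If the derivative of an absolutely continuous function that starts nonnegative is at least
`-n` wherever the function is negative, its negative part is at most the integral of `n`. -/
theorem negPart_le_integral {f g n : ℝ → ℝ} {a b : ℝ} (hf : ContinuousOn f (Icc a b))
    (hg : IntegrableOn g (Icc a b)) (hn : IntegrableOn n (Icc a b))
    (hn_nonneg : ∀ s ∈ Icc a b, 0 ≤ n s)
    (hfg : ∀ t ∈ Icc a b, f t = f a + ∫ s in a..t, g s) (ha : 0 ≤ f a)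
    (hgn : ∀ s ∈ Icc a b, f s < 0 → -n s ≤ g s) :
    ∀ t ∈ Icc a b, (f t)⁻ ≤ ∫ s in a..t, n s := by
  intro t ht
  have hsub : Icc a t ⊆ Icc a b := Icc_subset_Icc_right ht.2
  have hII : ∀ {h : ℝ → ℝ}, IntegrableOn h (Icc a b) → ∀ c ∈ Icc a t, ∀ d ∈ Icc a t,
      IntervalIntegrable h volume c d := fun hh c hc d hd =>
    (hh.mono_set ((uIcc_subset_Icc hc hd).trans hsub)).intervalIntegrable
  have hat : a ∈ Icc a t := left_mem_Icc.2 ht.1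
  have htt : t ∈ Icc a t := right_mem_Icc.2 ht.1
  have hnn : 0 ≤ ∫ s in a..t, n s :=
    intervalIntegral.integral_nonneg ht.1 fun s hs => hn_nonneg s (hsub hs)
  refine sup_le ?_ hnn
  have hclosed : IsClosed (Icc a t ∩ f ⁻¹' Ici 0) :=
    (hf.mono hsub).preimage_isClosed_of_isClosed isClosed_Icc isClosed_Ici
  obtain ⟨c, ⟨hc, hfc⟩, hcmax⟩ :=
    (isCompact_Icc.of_isClosed_subset hclosed inter_subset_left).exists_isGreatest ⟨a, hat, ha⟩
  have hfc : 0 ≤ f c := hfc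
  have hneg : ∀ s ∈ Ioo c t, f s < 0 := by
    intro s hs
    by_contra! h
    exact (hcmax ⟨⟨hc.1.trans hs.1.le, hs.2.le⟩, h⟩).not_gt hs.1
  have hincr : f t = f c + ∫ s in c..t, g s := by
    rw [hfg t ht, hfg c (hsub hc),
      ← intervalIntegral.integral_add_adjacent_intervals (hII hg a hat c hc) (hII hg c hc t htt)]
    ring
  have hlower : ∫ s in c..t, -n s ≤ ∫ s in c..t, g s :=
    intervalIntegral.integral_mono_on_of_le_Ioo hc.2 (hII hn c hc t htt).neg (hII hg c hc t htt)
      fun s hs => hgn s (hsub ⟨hc.1.trans hs.1.le, hs.2.le⟩) (hneg s hs)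
  rw [intervalIntegral.integral_neg] at hlower
  have hmono : ∫ s in c..t, n s ≤ ∫ s in a..t, n s :=
    intervalIntegral.integral_mono_interval hc.1 hc.2 le_rfl
      ((ae_restrict_iff' measurableSet_Ioc).2 <| .of_forall fun s hs =>
        hn_nonneg s (hsub (Ioc_subset_Icc_self hs))) (hII hn a hat t htt)
  linarith

/-- At a negative coordinate, the forward drift of a generator is bounded below in terms of the
negative parts of the state. -/
theorem neg_mul_sum_negPart_le_sum_mul {ι : Type*} [Fintype ι] {A : Matrix ι ι ℝ} {K : ℝ}
    (hA : ∀ i j, |A i j| ≤ K) (hA_nonneg : ∀ i j, j ≠ i → 0 ≤ A i j)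
    (hA_rowsum : ∀ i, ∑ j, A i j = 0) (x : ι → ℝ) {j : ι} (hj : x j < 0) :
    -(K * ∑ i, (x i)⁻) ≤ ∑ i, x i * A i j := by
  classical
  rw [Finset.mul_sum, ← Finset.sum_neg_distrib]
  refine Finset.sum_le_sum fun i _ => ?_
  have hxi : 0 ≤ (x i)⁻ := negPart_nonneg _
  have hK : 0 ≤ K := (abs_nonneg _).trans (hA i j)
  rcases eq_or_ne j i with rfl | hji
  · have hdiag : A j j ≤ 0 := by
      have h := hA_rowsum j
      rw [← Finset.add_sum_erase _ _ (Finset.mem_univ j)] at h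
      have : 0 ≤ ∑ k ∈ Finset.univ.erase j, A j k :=
        Finset.sum_nonneg fun k hk => hA_nonneg j k (Finset.ne_of_mem_erase hk)
      linarith
    nlinarith [mul_nonneg hK hxi, mul_nonneg_of_nonpos_of_nonpos hj.le hdiag]
  · have h0 := hA_nonneg i j hji
    have h1 := (le_abs_self _).trans (hA i j)
    have h2 : -x i ≤ (x i)⁻ := neg_le_negPart _
    nlinarith [mul_le_mul_of_nonneg_right h1 hxi, mul_le_mul_of_nonneg_right h2 h0]

/-- invariance of the probability simplex under the forward equation.
If each `Q_s` is a generator matrix (bounded, measurable in `s`), `ρ` is a probability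
vector and `μ` is the continuous solution of `μ_t = ρ + ∫_0^t μ_s Q_s ds`, then `μ_t`
is a probability vector for every `t ∈ [0,T]`. -/
theorem forward_equation_preserves_simplex
    {m : ℕ} (hm : 0 < m) (T : ℝ) (hT : 0 < T) (K₁ : ℝ)
    (Q : ℝ → Matrix (Fin m) (Fin m) ℝ)
    (hQmeas : ∀ i j, Measurable fun s => Q s i j)
    (hQbdd : ∀ s ∈ Set.Icc (0:ℝ) T, ∀ i j, |Q s i j| ≤ K₁)
    (hQ_nonneg : ∀ s ∈ Set.Icc (0:ℝ) T, ∀ i j, j ≠ i → 0 ≤ Q s i j)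
    (hQ_rowsum : ∀ s ∈ Set.Icc (0:ℝ) T, ∀ i, ∑ j, Q s i j = 0)
    (ρ : Fin m → ℝ) (hρ : IsProbVec ρ)
    (μ : ℝ → Fin m → ℝ)
    (hμcont : ∀ j, ContinuousOn (fun t => μ t j) (Set.Icc (0:ℝ) T))
    (hμ : ∀ t ∈ Set.Icc (0:ℝ) T, ∀ j,
      μ t j = ρ j + ∫ s in (0:ℝ)..t, ∑ i, μ s i * Q s i j) :
    ∀ t ∈ Set.Icc (0:ℝ) T, IsProbVec (μ t) := by
  have hprod : ∀ i j, IntegrableOn (fun s => μ s i * Q s i j) (Icc 0 T) := by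
    intro i j
    refine IntegrableOn.continuousOn_mul (hμcont i) ?_ isCompact_Icc
    refine Measure.integrableOn_of_bounded (M := K₁) measure_Icc_lt_top.ne
      (hQmeas i j).aestronglyMeasurable ?_
    exact (ae_restrict_iff' measurableSet_Icc).2 (.of_forall fun s hs => hQbdd s hs i j)
  have hdrift : ∀ j, IntegrableOn (fun s => ∑ i, μ s i * Q s i j) (Icc 0 T) := fun j =>
    integrable_finsetSum _ fun i _ => hprod i j
  have h0 : (0 : ℝ) ∈ Icc 0 T := left_mem_Icc.2 hT.le
  have hμ0 : ∀ j, μ 0 j = ρ j := fun j => by simpa using hμ 0 h0 j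
  have hK : 0 ≤ K₁ := (abs_nonneg _).trans (hQbdd 0 h0 ⟨0, hm⟩ ⟨0, hm⟩)
  set N : ℝ → ℝ := fun s => ∑ i, (μ s i)⁻
  have hN_nonneg : ∀ s, 0 ≤ N s := fun s => Finset.sum_nonneg fun i _ => negPart_nonneg _
  have hNcont : ContinuousOn N (Icc 0 T) :=
    continuousOn_finsetSum _ fun i _ => (hμcont i).neg.sup continuousOn_const
  have hbound : ∀ t ∈ Icc 0 T, ∀ j, (μ t j)⁻ ≤ ∫ s in (0 : ℝ)..t, K₁ * N s := by
    intro t ht j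
    refine negPart_le_integral (f := fun t => μ t j) (hμcont j) (hdrift j)
      (hNcont.integrableOn_Icc.const_mul K₁) (fun s _ => mul_nonneg hK (hN_nonneg s))
      (fun s hs => ?_) ((hρ.1 j).trans_eq (hμ0 j).symm) (fun s hs hneg => ?_) t ht
    · rw [hμ0 j]
      exact hμ s hs j
    · exact neg_mul_sum_negPart_le_sum_mul (hQbdd s hs) (hQ_nonneg s hs) (hQ_rowsum s hs)
        (μ s) hneg
  have hNzero : ∀ t ∈ Icc 0 T, N t = 0 := by
    refine eq_zero_of_le_mul_integral (C := m * K₁) hNcont (fun t _ => hN_nonneg t) fun t ht => ?_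
    refine (Finset.sum_le_sum fun j _ => hbound t ht j).trans_eq ?_
    rw [intervalIntegral.integral_const_mul, Finset.sum_const, Finset.card_univ, Fintype.card_fin,
      nsmul_eq_mul, mul_assoc]
  intro t ht
  refine ⟨fun j => ?_, ?_⟩
  · have h := (Finset.sum_eq_zero_iff_of_nonneg fun i _ => negPart_nonneg (μ t i)).1
      (hNzero t ht) j (Finset.mem_univ j)
    exact negPart_eq_zero.1 h
  · have hII : ∀ j, IntervalIntegrable (fun s => ∑ i, μ s i * Q s i j) volume 0 t := fun j =>
      ((hdrift j).mono_set (uIcc_subset_Icc h0 ht)).intervalIntegrable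
    have hmass : ∫ s in (0 : ℝ)..t, ∑ j, ∑ i, μ s i * Q s i j = 0 := by
      refine intervalIntegral.integral_zero_ae (.of_forall fun s hs => ?_)
      rw [uIoc_of_le ht.1] at hs
      rw [Finset.sum_comm]
      refine Finset.sum_eq_zero fun i _ => ?_
      rw [← Finset.mul_sum, hQ_rowsum s ⟨hs.1.le, hs.2.trans ht.2⟩, mul_zero]
    rw [Finset.sum_congr rfl fun j _ => hμ t ht j, Finset.sum_add_distrib, hρ.2,
      ← intervalIntegral.integral_finsetSum fun j _ => hII j, hmass, add_zero]
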